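/- Let P be a finite presentation and let S₀ be the subset of the generators corresponding to the free edges of K(P). Let x be a generator that is contained in some relator but is not in S₀. Then there exists a closed oriented surface diagram f: F → K(P) that contains an edge labeled x and which is reducible only at edges labeled by elements of S₀ (that is, every folding edge of F carries a label from S₀). -/

import Mathlib

/-!
Common combinatorial framework for formalizing "directed diagrammatic reducibility"
(Harlander–Rosebrock).  Words, presentations, combinatorial 2-complexes,
combinatorial maps, spherical/disc/surface diagrams, folding edges, universal
covers, subcomplexes and collapses, relative presentations and spherical
pictures (in their dual-diagram form), Whitehead graphs, small cancellation
conditions and labeled oriented trees.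
-/

namespace DDR

open scoped Classical

/-- A word in the generators `α`: a list of (generator, sign). -/
abbrev Word (α : Type) := List (α × Bool)

namespace Word

/-- The inverse word. -/
def inv {α : Type} (w : Word α) : Word α := (w.map (fun p => (p.1, !p.2))).reverse

/-- The element of the free group represented by a word. -/
def toFree {α : Type} (w : Word α) : FreeGroup α :=
  (w.map (fun p => if p.2 then FreeGroup.of p.1 else (FreeGroup.of p.1)⁻¹)).prod

/-- Apply a map of generators to a word. -/
def mapGen {α β : Type} (f : α → β) (w : Word α) : Word β := w.map (fun p => (f p.1, p.2))

/-- A word is (freely) reduced: no adjacent cancelling pair. -/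
def Reduced {α : Type} (w : Word α) : Prop := w.Chain' (fun p q => p.1 ≠ q.1 ∨ p.2 = q.2)

/-- A word is cyclically reduced: every rotation of it is reduced. -/
def CyclicallyReduced {α : Type} (w : Word α) : Prop := ∀ n : ℕ, Reduced (w.rotate n)

/-- Exponent sum of a word. -/
def expSum {α : Type} (w : Word α) : ℤ := (w.map (fun p => if p.2 then (1:ℤ) else -1)).sum

/-- All letters of the word come from the subset `S` of the generators. -/
def onSet {α : Type} (w : Word α) (S : Set α) : Prop := ∀ p ∈ w, p.1 ∈ S

/-- View a word on letters from `S` as a word over `S`. -/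
noncomputable def restrict {α : Type} (w : Word α) (S : Set α) : Word S :=
  w.filterMap (fun p => if h : p.1 ∈ S then some (⟨p.1, h⟩, p.2) else none)

/-- Substitute each generator by a word. -/
def subst {α β : Type} (w₀ : α → Word β) (w : Word α) : Word β :=
  w.flatMap (fun p => if p.2 then w₀ p.1 else Word.inv (w₀ p.1))

end Word

/-- A (finite) presentation with generating set `α`, given by its list of relators. -/
structure Presentation (α : Type) where
  relators : List (Word α)

namespace Presentation

variable {α : Type}

/-- The relators, as a subset of the free group. -/
def rels (P : Presentation α) : Set (FreeGroup α) := {g | ∃ r ∈ P.relators, g = Word.toFree r}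

/-- The group `G(P)` defined by the presentation. -/
def group (P : Presentation α) : Type := PresentedGroup P.rels

instance (P : Presentation α) : Group P.group :=
  inferInstanceAs (Group (PresentedGroup P.rels))

/-- The image in `G(P)` of a generator. -/
def gen (P : Presentation α) (x : α) : P.group := PresentedGroup.of x

/-- The projection from the free group onto `G(P)`. -/
def pr (P : Presentation α) : FreeGroup α →* P.group :=
  QuotientGroup.mk' (Subgroup.normalClosure P.rels)

/-- The element of `G(P)` represented by a word. -/
def proj (P : Presentation α) (w : Word α) : P.group := P.pr (Word.toFree w)

/-- The sub-presentation `P_S` carried by a subset `S` of the generators: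
its generators are `S` and its relators are those relators of `P` that are
words in `S^{±1}`. -/
noncomputable def sub (P : Presentation α) (S : Set α) : Presentation S :=
  ⟨(P.relators.filter (fun w => decide (Word.onSet w S))).map (fun w => Word.restrict w S)⟩

/-- `ψ : G(P_S) → G(P)` is the inclusion induced homomorphism. -/
def IsInclusionHom (P : Presentation α) (S : Set α)
    (ψ : (P.sub S).group →* P.group) : Prop :=
  ∀ s : S, ψ ((P.sub S).gen s) = P.gen s.1

end Presentation

/-- A combinatorial 2-complex: vertices, oriented edges and 2-cells; every
2-cell has a boundary word (a closed edge path) in the edges. -/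
structure TwoComplex where
  V : Type
  E : Type
  F : Type
  src : E → V
  tgt : E → V
  bdry : F → Word E

namespace TwoComplex

/-- The occurrences of the edge `e` among the boundary paths of the 2-cells:
a 2-cell `f`, a position `i` in its boundary word, and the direction in which
`e` is traversed there. -/
def Occ (C : TwoComplex) (e : C.E) : Type :=
  {p : C.F × ℕ × Bool // (C.bdry p.1)[p.2.1]? = some (e, p.2.2)}

/-- Adjacency of vertices in the 1-skeleton. -/
def adj (C : TwoComplex) (v w : C.V) : Prop :=
  ∃ e, (C.src e = v ∧ C.tgt e = w) ∨ (C.src e = w ∧ C.tgt e = v)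

/-- The complex is connected (via its 1-skeleton). -/
def Connected (C : TwoComplex) : Prop :=
  Nonempty C.V ∧ ∀ v w : C.V, Relation.ReflTransGen C.adj v w

/-- Every edge lies on exactly two 2-cell boundary sides: the complex is a
closed (pseudo)surface. -/
def Closed (C : TwoComplex) : Prop := ∀ e : C.E, Nat.card (C.Occ e) = 2

/-- The complex is finite. -/
def FiniteCx (C : TwoComplex) : Prop := Finite C.V ∧ Finite C.E ∧ Finite C.F

/-- A combinatorial 2-sphere: finite, connected, closed, Euler characteristic `2`. -/
def IsSphere (C : TwoComplex) : Prop :=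
  C.FiniteCx ∧ C.Connected ∧ C.Closed ∧
    Nat.card C.V + Nat.card C.F = Nat.card C.E + 2

/-- A choice of orientations of the 2-cells is an orientation if the two sides
of each edge traverse it in opposite directions. -/
def IsOrientation (C : TwoComplex) (orn : C.F → Bool) : Prop :=
  ∀ (e : C.E) (o₁ o₂ : C.Occ e), (o₁.1.1, o₁.1.2.1) ≠ (o₂.1.1, o₂.1.2.1) →
    Bool.xor o₁.1.2.2 (orn o₁.1.1) ≠ Bool.xor o₂.1.2.2 (orn o₂.1.1)

/-- The complex is orientable. -/
def Orientable (C : TwoComplex) : Prop := ∃ orn, C.IsOrientation orn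

/-- A (connected) closed combinatorial surface. -/
def IsClosedSurface (C : TwoComplex) : Prop := C.FiniteCx ∧ C.Connected ∧ C.Closed

/-- A boundary edge: it occurs at most once among the boundaries of 2-cells. -/
def BoundaryEdge (C : TwoComplex) (e : C.E) : Prop := Nat.card (C.Occ e) ≤ 1

/-- A combinatorial disc: finite, connected, every edge on at most two sides,
Euler characteristic `1`. -/
def IsDisc (C : TwoComplex) : Prop :=
  C.FiniteCx ∧ C.Connected ∧ (∀ e : C.E, Nat.card (C.Occ e) ≤ 2) ∧
    Nat.card C.V + Nat.card C.F = Nat.card C.E + 1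

end TwoComplex

/-- A combinatorial map between 2-complexes: it sends cells to cells of the
same dimension; the boundary word of a 2-cell is sent to the boundary word of
the image 2-cell, up to rotation (`rot`) and, when `sgn = false`, inversion. -/
structure CombMap (C K : TwoComplex) where
  onV : C.V → K.V
  onE : C.E → K.E
  onF : C.F → K.F
  src_eq : ∀ e, onV (C.src e) = K.src (onE e)
  tgt_eq : ∀ e, onV (C.tgt e) = K.tgt (onE e)
  sgn : C.F → Bool
  rot : C.F → ℕ
  bdry_eq : ∀ f, (C.bdry f).map (fun p => (onE p.1, p.2)) =
      ((if sgn f then K.bdry (onF f) else Word.inv (K.bdry (onF f))).rotate (rot f))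

namespace CombMap

variable {C K : TwoComplex}

/-- Position in the boundary word of the target 2-cell corresponding to
position `i` in the boundary word of the 2-cell `f`. -/
def kIndex (φ : CombMap C K) (f : C.F) (i : ℕ) : ℕ :=
  let n := (K.bdry (φ.onF f)).length
  if φ.sgn f then (i + φ.rot f) % n else n - 1 - ((i + φ.rot f) % n)

/-- `e` is a folding edge of the diagram `φ : C → K`: two distinct 2-cell
sides at `e` map to the same 2-cell of `K` with opposite orientations,
matching up along `e` (folding over `e`). -/
def FoldingEdge (φ : CombMap C K) (e : C.E) : Prop :=
  ∃ o₁ o₂ : C.Occ e, (o₁.1.1, o₁.1.2.1) ≠ (o₂.1.1, o₂.1.2.1) ∧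
    φ.onF o₁.1.1 = φ.onF o₂.1.1 ∧ φ.sgn o₁.1.1 ≠ φ.sgn o₂.1.1 ∧
    φ.kIndex o₁.1.1 o₁.1.2.1 = φ.kIndex o₂.1.1 o₂.1.2.1

end CombMap

namespace Presentation

variable {α : Type}

/-- The standard 2-complex `K(P)` of a presentation: one vertex, one edge per
generator, one 2-cell per relator. -/
def complex (P : Presentation α) : TwoComplex where
  V := Unit
  E := α
  F := Fin P.relators.length
  src := fun _ => ()
  tgt := fun _ => ()
  bdry := fun j => P.relators.get j

/-- `P` is DR directed away from `S`: every spherical diagram over `K(P)`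
containing an edge whose label is not in `S` contains a folding edge whose
label is not in `S`. -/
def DRAway (P : Presentation α) (S : Set α) : Prop :=
  ∀ (C : TwoComplex) (φ : CombMap C P.complex), C.IsSphere →
    (∃ e, φ.onE e ∉ S) → ∃ e, φ.FoldingEdge e ∧ φ.onE e ∉ S

/-- `P` is DR in all directions: for each generator `x`, every spherical
diagram containing an edge labeled `x` contains a folding edge labeled `x`. -/
def DRAll (P : Presentation α) : Prop :=
  ∀ (C : TwoComplex) (φ : CombMap C P.complex) (x : α), C.IsSphere →
    (∃ e, φ.onE e = x) → ∃ e, φ.FoldingEdge e ∧ φ.onE e = x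

/-- The number of occurrences of the generator `x` among the relators of `P`. -/
noncomputable def occCount (P : Presentation α) (x : α) : ℕ :=
  (P.relators.map (fun w => w.countP (fun p => decide (p.1 = x)))).sum

end Presentation

/-- Lift a word at the basepoint `g` to the Cayley graph of a group. -/
def liftWord {α : Type} {G : Type} [Group G] (ofg : α → G) : G → Word α → Word (G × α)
  | _, [] => []
  | g, (x, true) :: w => ((g, x), true) :: liftWord ofg (g * ofg x) w
  | g, (x, false) :: w => ((g * (ofg x)⁻¹, x), false) :: liftWord ofg (g * (ofg x)⁻¹) w

/-- The universal cover of `K(P)`: vertices the elements of `G(P)`, edges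
`(g,x)`, 2-cells `(g,r)` attached along lifts of the relators. -/
def Presentation.cover {α : Type} (P : Presentation α) : TwoComplex where
  V := P.group
  E := P.group × α
  F := P.group × Fin P.relators.length
  src := fun e => e.1
  tgt := fun e => e.1 * P.gen e.2
  bdry := fun f => liftWord P.gen f.1 (P.relators.get f.2)

/-- A subcomplex of a 2-complex. -/
structure Subcomplex (C : TwoComplex) where
  V' : Set C.V
  E' : Set C.E
  F' : Set C.F
  src_mem : ∀ e ∈ E', C.src e ∈ V'
  tgt_mem : ∀ e ∈ E', C.tgt e ∈ V'
  bdry_mem : ∀ f ∈ F', ∀ p ∈ C.bdry f, p.1 ∈ E'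

/-- The subcomplex is finite. -/
def Subcomplex.FiniteSub {C : TwoComplex} (X : Subcomplex C) : Prop :=
  X.V'.Finite ∧ X.E'.Finite ∧ X.F'.Finite

/-- In the subcomplex `X`, the edge `e` is a free edge of the 2-cell `f`:
`f` is the only 2-cell of `X` containing `e`, and contains it exactly once. -/
def FreeEdgeIn (C : TwoComplex) (X : Subcomplex C) (e : C.E) (f : C.F) : Prop :=
  f ∈ X.F' ∧ e ∈ X.E' ∧
    (∀ f' ∈ X.F', ∀ p ∈ C.bdry f', p.1 = e → f' = f) ∧
    (C.bdry f).countP (fun p => decide (p.1 = e)) = 1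

/-- `CollapsesTo C Q X Y`: the subcomplex `X` collapses to the subcomplex `Y`
by a sequence of elementary collapses, each removing a 2-cell together with a
free edge satisfying the constraint `Q`. -/
inductive CollapsesTo (C : TwoComplex) (Q : C.E → Prop) :
    Subcomplex C → Subcomplex C → Prop
  | refl (X : Subcomplex C) : CollapsesTo C Q X X
  | step {X Y Z : Subcomplex C} (e : C.E) (f : C.F) :
      Q e → FreeEdgeIn C X e f →
      Y.V' = X.V' → Y.E' = X.E' \ {e} → Y.F' = X.F' \ {f} →
      CollapsesTo C Q Y Z → CollapsesTo C Q X Z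

/-- The whole of `K(P)` as a subcomplex of itself. -/
def Presentation.topCx {α : Type} (P : Presentation α) : Subcomplex P.complex :=
  ⟨Set.univ, Set.univ, Set.univ, fun _ _ => trivial, fun _ _ => trivial,
    fun _ _ _ _ => trivial⟩

/-- `K(P_S)` as a subcomplex of `K(P)`. -/
def Presentation.subCx {α : Type} (P : Presentation α) (S : Set α) : Subcomplex P.complex :=
  ⟨Set.univ, S, {j | Word.onSet (P.relators.get j) S},
    fun _ _ => trivial, fun _ _ => trivial, fun _ hf p hp => hf p hp⟩

/-! ### Relative presentations and spherical pictures (in dual-diagram form) -/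

/-- A relator of a relative presentation `⟨H, x | r⟩`:
a list of pairs `((x,ε), h)`, spelling `x₁^{ε₁} h₁ x₂^{ε₂} h₂ ⋯`. -/
abbrev RelWord (X H : Type) := List ((X × Bool) × H)

/-- The word in the generators `x` underlying a relative relator. -/
def RelWord.xword {X H : Type} (r : RelWord X H) : Word X := r.map Prod.fst

/-- A relative presentation `⟨H, x | r⟩`. -/
structure RelPresentation (X H : Type) [Group H] where
  relators : List (RelWord X H)

/-- Position in a relative relator corresponding to position `i` of a 2-cell
with orientation `s` and rotation `rot`. -/
def relKIndex (n : ℕ) (s : Bool) (rot i : ℕ) : ℕ :=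
  if s then (i + rot) % n else n - 1 - ((i + rot) % n)

/-- A spherical picture over a relative presentation, encoded by its dual
spherical diagram: a combinatorial 2-sphere whose edges (dual to the arcs)
are labeled by generators from `x`, whose 2-cells (dual to the discs) are
labeled by relators with a sign, and whose vertices (dual to the regions)
carry the cyclic sequence of corners of 2-cells around them. -/
structure RelPicture {X H : Type} [Group H] (Q : RelPresentation X H) where
  C : TwoComplex
  edgeLabel : C.E → X
  faceLabel : C.F → Fin Q.relators.length
  sgn : C.F → Bool
  rot : C.F → ℕ
  cornerSeq : C.V → List (C.F × ℕ)
  sphere : C.IsSphere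
  bdry_eq : ∀ f, (C.bdry f).map (fun p => (edgeLabel p.1, p.2)) =
      ((if sgn f then RelWord.xword (Q.relators.get (faceLabel f))
        else Word.inv (RelWord.xword (Q.relators.get (faceLabel f)))).rotate (rot f))

namespace RelPicture

variable {X H : Type} [Group H] {Q : RelPresentation X H}

/-- The `H`-label of a corner of a 2-cell of the picture. -/
noncomputable def cornerH (Pic : RelPicture Q) (c : Pic.C.F × ℕ) : H :=
  let r := Q.relators.get (Pic.faceLabel c.1)
  match r[relKIndex r.length (Pic.sgn c.1) (Pic.rot c.1) c.2]? with
  | some a => if Pic.sgn c.1 then a.2 else a.2⁻¹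
  | none => 1

/-- The corner labels around each region multiply to `1` in `H`. -/
def CornerCond (Pic : RelPicture Q) : Prop :=
  ∀ v, ((Pic.cornerSeq v).map Pic.cornerH).prod = 1

/-- The picture contains a dipole: two 2-cells (discs) carrying the same
relator with opposite signs, joined along a connecting edge (arc) so that the
labels match up. -/
def HasDipole (Pic : RelPicture Q) : Prop :=
  ∃ (e : Pic.C.E) (o₁ o₂ : Pic.C.Occ e), (o₁.1.1, o₁.1.2.1) ≠ (o₂.1.1, o₂.1.2.1) ∧
    Pic.faceLabel o₁.1.1 = Pic.faceLabel o₂.1.1 ∧ Pic.sgn o₁.1.1 ≠ Pic.sgn o₂.1.1 ∧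
    relKIndex (Q.relators.get (Pic.faceLabel o₁.1.1)).length (Pic.sgn o₁.1.1)
        (Pic.rot o₁.1.1) o₁.1.2.1 =
      relKIndex (Q.relators.get (Pic.faceLabel o₂.1.1)).length (Pic.sgn o₂.1.1)
        (Pic.rot o₂.1.1) o₂.1.2.1

/-- The picture is reduced: it contains no dipole. -/
def Reduced (Pic : RelPicture Q) : Prop := ¬Pic.HasDipole

/-- The picture contains an arc labeled `x`. -/
def HasLabel (Pic : RelPicture Q) (x : X) : Prop := ∃ e, Pic.edgeLabel e = x

end RelPicture

/-- A relative presentation is DR (diagrammatically reducible) if every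
connected spherical picture over it (containing at least one disc)
contains a dipole. -/
def RelPresentation.DR {X H : Type} [Group H] (Q : RelPresentation X H) : Prop :=
  ∀ Pic : RelPicture Q, Pic.CornerCond → Nonempty Pic.C.F → Pic.HasDipole

/-- Spell out a relative relator, whose `H`-coefficients have been lifted to
words `u_i` over the generators `x₀`, as an ordinary word over `x₀ ⊕ x`. -/
def interleave {α₀ X : Type} (l : List ((X × Bool) × Word α₀)) : Word (α₀ ⊕ X) :=
  l.flatMap (fun p => (Sum.inr p.1.1, p.1.2) :: Word.mapGen Sum.inl p.2)

/-- `P` is an ordinary presentation associated to the relative presentation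
`Q = ⟨H, x | rh⟩` via the presentation `P₀` of `H`: each `H`-coefficient of
each relative relator is replaced by a word over `x₀` representing it, and
the relators of `P₀` are added. -/
def Assoc {α₀ X : Type} (P₀ : Presentation α₀) (Q : RelPresentation X P₀.group)
    (P : Presentation (α₀ ⊕ X)) : Prop :=
  ∃ lifts : List (List ((X × Bool) × Word α₀)),
    List.Forall₂ (fun rh lr => List.Forall₂
        (fun (a : (X × Bool) × P₀.group) (b : (X × Bool) × Word α₀) =>
          a.1 = b.1 ∧ P₀.proj b.2 = a.2) rh lr) Q.relators lifts ∧
      P.relators = P₀.relators.map (Word.mapGen Sum.inl) ++ lifts.map interleave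

/-- `ψ : H = G(P₀) → G(P)` is the homomorphism induced by the inclusion of
the generators `x₀`. -/
def InclHom {α₀ X : Type} (P₀ : Presentation α₀) (P : Presentation (α₀ ⊕ X))
    (ψ : P₀.group →* P.group) : Prop :=
  ∀ a : α₀, ψ (P₀.gen a) = P.gen (Sum.inl a)

/-- The complex `Y` obtained from the universal cover of `K(P)` by
contracting each component of `p⁻¹(K(P₀))` to a point: vertices are the
components, the edges and 2-cells are those not coming from `P₀`, and
boundary words retain only the edges labeled in `x`. -/
def Ycomplex {α₀ X : Type} (P₀ : Presentation α₀) (P : Presentation (α₀ ⊕ X)) :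
    TwoComplex where
  V := Quot (fun g g' : P.group => ∃ a : α₀,
        g' = g * P.gen (Sum.inl a) ∨ g = g' * P.gen (Sum.inl a))
  E := P.group × X
  F := P.group × {j : Fin P.relators.length // P₀.relators.length ≤ (j : ℕ)}
  src := fun e => Quot.mk _ e.1
  tgt := fun e => Quot.mk _ (e.1 * P.gen (Sum.inr e.2))
  bdry := fun f => (liftWord P.gen f.1 (P.relators.get f.2.1)).filterMap
    (fun p => match p.1.2 with
      | Sum.inl _ => none
      | Sum.inr x => some ((p.1.1, x), p.2))

/-- Extension of a substitution of the old generators by the identity on the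
new generators. -/
def extSubst {α β γ : Type} (w₀ : α → Word β) : (α ⊕ γ) → Word (β ⊕ γ)
  | Sum.inl a => Word.mapGen Sum.inl (w₀ a)
  | Sum.inr g => [(Sum.inr g, true)]

/-! ### Multigraphs, Whitehead graphs -/

/-- A multigraph. -/
structure MultiGraph where
  V : Type
  E : Type
  src : E → V
  tgt : E → V

namespace MultiGraph

/-- Start vertex of a directed edge. -/
def epSrc (G : MultiGraph) (p : G.E × Bool) : G.V := if p.2 then G.src p.1 else G.tgt p.1

/-- End vertex of a directed edge. -/
def epTgt (G : MultiGraph) (p : G.E × Bool) : G.V := if p.2 then G.tgt p.1 else G.src p.1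

/-- A closed walk (cyclically indexed). -/
def ClosedWalk (G : MultiGraph) (w : List (G.E × Bool)) : Prop :=
  w ≠ [] ∧ ∀ i : Fin w.length,
    G.epTgt (w.get i) = G.epSrc (w.get ⟨((i : ℕ) + 1) % w.length, Nat.mod_lt _ i.pos⟩)

/-- A cyclically reduced walk: no backtracking, cyclically. -/
def ReducedWalk (G : MultiGraph) (w : List (G.E × Bool)) : Prop :=
  ∀ i : Fin w.length,
    ¬((w.get i).1 = (w.get ⟨((i : ℕ) + 1) % w.length, Nat.mod_lt _ i.pos⟩).1 ∧
      (w.get i).2 ≠ (w.get ⟨((i : ℕ) + 1) % w.length, Nat.mod_lt _ i.pos⟩).2)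

/-- A cycle: a reduced closed walk. -/
def IsCycle (G : MultiGraph) (w : List (G.E × Bool)) : Prop :=
  G.ClosedWalk w ∧ G.ReducedWalk w

/-- A forest: no cycles. -/
def IsForest (G : MultiGraph) : Prop := ¬∃ w, G.IsCycle w

/-- Adjacency. -/
def adjG (G : MultiGraph) (v w : G.V) : Prop :=
  ∃ e, (G.src e = v ∧ G.tgt e = w) ∨ (G.src e = w ∧ G.tgt e = v)

/-- Connectivity. -/
def ConnectedG (G : MultiGraph) : Prop :=
  Nonempty G.V ∧ ∀ v w : G.V, Relation.ReflTransGen G.adjG v w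

/-- A tree: a connected forest. -/
def IsTree (G : MultiGraph) : Prop := G.IsForest ∧ G.ConnectedG

end MultiGraph

/-- The corners of the relators of `P`: a relator together with a position in
it (the corner between the letter at that position and the cyclically next
letter). -/
def Corner {α : Type} (P : Presentation α) : Type :=
  Σ j : Fin P.relators.length, Fin (P.relators.get j).length

/-- First letter of a corner. -/
def cornerFst {α : Type} (P : Presentation α) (c : Corner P) : α × Bool :=
  (P.relators.get c.1).get c.2

/-- Second (cyclically next) letter of a corner. -/
def cornerSnd {α : Type} (P : Presentation α) (c : Corner P) : α × Bool :=
  (P.relators.get c.1).get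
    ⟨((c.2 : ℕ) + 1) % (P.relators.get c.1).length, Nat.mod_lt _ c.2.pos⟩

/-- The endpoint of a corner in the Whitehead graph coming from its first
letter: traversing `x^{+1}` we arrive near `x⁻`, traversing `x^{-1}`
near `x⁺`. (`(x, true)` denotes `x⁺`, `(x, false)` denotes `x⁻`.) -/
def cornerSrcW {α : Type} (P : Presentation α) (c : Corner P) : α × Bool :=
  ((cornerFst P c).1, !(cornerFst P c).2)

/-- The endpoint of a corner in the Whitehead graph coming from its second
letter. -/
def cornerTgtW {α : Type} (P : Presentation α) (c : Corner P) : α × Bool :=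
  cornerSnd P c

/-- The Whitehead graph of a presentation: vertices `x⁺ = (x, true)` and
`x⁻ = (x, false)` for each generator `x`, one edge for each corner of each
relator. -/
def WhiteheadG {α : Type} (P : Presentation α) : MultiGraph where
  V := α × Bool
  E := Corner P
  src := cornerSrcW P
  tgt := cornerTgtW P

/-- The positive Whitehead graph `W⁺(P)`: the full subgraph of `W(P)` on the
vertices `x⁺`. -/
def WhiteheadPos {α : Type} (P : Presentation α) : MultiGraph where
  V := α
  E := {c : Corner P // (cornerSrcW P c).2 = true ∧ (cornerTgtW P c).2 = true}
  src := fun c => (cornerSrcW P c.1).1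
  tgt := fun c => (cornerTgtW P c.1).1

/-- The negative Whitehead graph `W⁻(P)`: the full subgraph of `W(P)` on the
vertices `x⁻`. -/
def WhiteheadNeg {α : Type} (P : Presentation α) : MultiGraph where
  V := α
  E := {c : Corner P // (cornerSrcW P c).2 = false ∧ (cornerTgtW P c).2 = false}
  src := fun c => (cornerSrcW P c.1).1
  tgt := fun c => (cornerTgtW P c.1).1

/-! ### Small cancellation conditions -/

/-- No cancellation between the end of `w₁` and the beginning of `w₂`. -/
def NoCancel {α : Type} (w₁ w₂ : Word α) : Prop :=
  ¬∃ (x : α) (b : Bool), w₁.getLast? = some (x, b) ∧ w₂.head? = some (x, !b)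

namespace Presentation

variable {α : Type}

/-- The symmetrized relator set: all cyclic permutations of the relators and
their inverses. -/
def symm (P : Presentation α) : Set (Word α) :=
  {w | ∃ r ∈ P.relators, ∃ n : ℕ, w = r.rotate n ∨ w = (Word.inv r).rotate n}

/-- A piece: a nonempty common prefix of two distinct elements of the
symmetrized relator set. -/
def IsPiece (P : Presentation α) (u : Word α) : Prop :=
  u ≠ [] ∧ ∃ w₁ ∈ P.symm, ∃ w₂ ∈ P.symm, w₁ ≠ w₂ ∧ u <+: w₁ ∧ u <+: w₂

/-- The small cancellation condition `C(p)`: no element of the symmetrized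
set is a product of fewer than `p` pieces. -/
def CondC (P : Presentation α) (p : ℕ) : Prop :=
  ∀ w ∈ P.symm, ∀ l : List (Word α), (∀ u ∈ l, P.IsPiece u) → l.flatten = w →
    p ≤ l.length


/-- The small cancellation condition `T(q)`: for every `h` with `3 ≤ h < q`,
every cyclic sequence of `h` elements of the symmetrized set in which no term
is the inverse of its predecessor has some pair of cyclically consecutive
terms whose product is reduced without cancellation. -/
def CondT (P : Presentation α) (q : ℕ) : Prop :=
  ∀ l : List (Word α), 3 ≤ l.length → l.length < q → (∀ w ∈ l, w ∈ P.symm) →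
    (∀ i : Fin l.length,
      l.get ⟨((i : ℕ) + 1) % l.length, Nat.mod_lt _ i.pos⟩ ≠ Word.inv (l.get i)) →
    ∃ i : Fin l.length,
      NoCancel (l.get i) (l.get ⟨((i : ℕ) + 1) % l.length, Nat.mod_lt _ i.pos⟩)

end Presentation

/-! ### Labeled oriented trees -/

/-- A labeled oriented graph: a list of edges `(initial vertex, terminal
vertex, label)`, where labels are vertices. -/
structure LOT (V : Type) where
  edges : List (V × V × V)

namespace LOT

variable {V : Type}

/-- The underlying graph. -/
def graph (L : LOT V) : MultiGraph where
  V := V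
  E := Fin L.edges.length
  src := fun i => (L.edges.get i).1
  tgt := fun i => (L.edges.get i).2.1

/-- The LOT presentation: for each edge from `u₁` to `u₂` labeled `u₃`, the
relator `u₁ u₃ (u₃ u₂)⁻¹`. -/
def pres (L : LOT V) : Presentation V :=
  ⟨L.edges.map (fun t => [(t.1, true), (t.2.2, true), (t.2.1, false), (t.2.2, false)])⟩

/-- A LOT is compressed if each relator consists of three different
generators. -/
def Compressed (L : LOT V) : Prop :=
  ∀ t ∈ L.edges, t.1 ≠ t.2.1 ∧ t.1 ≠ t.2.2 ∧ t.2.1 ≠ t.2.2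

/-- The set of vertices met by a set `T` of edges. -/
def vertexSet (L : LOT V) (T : Set (Fin L.edges.length)) : Set V :=
  {v | ∃ i ∈ T, (L.edges.get i).1 = v ∨ (L.edges.get i).2.1 = v}

/-- The subgraph spanned by a set of edges. -/
def subgraph (L : LOT V) (T : Set (Fin L.edges.length)) : MultiGraph where
  V := L.vertexSet T
  E := T
  src := fun i => ⟨(L.edges.get i.1).1, ⟨i.1, i.2, Or.inl rfl⟩⟩
  tgt := fun i => ⟨(L.edges.get i.1).2.1, ⟨i.1, i.2, Or.inr rfl⟩⟩

/-- The set of edges `T` spans a sub-LOT (with vertex set `L.vertexSet T`):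
it is nonempty, connected, and the labels of its edges are among its
vertices. -/
def IsSubLOT (L : LOT V) (T : Set (Fin L.edges.length)) : Prop :=
  T.Nonempty ∧ (L.subgraph T).ConnectedG ∧
    ∀ i ∈ T, (L.edges.get i).2.2 ∈ L.vertexSet T

/-- `T` spans a maximal proper sub-LOT. -/
def IsMaxProperSubLOT (L : LOT V) (T : Set (Fin L.edges.length)) : Prop :=
  L.IsSubLOT T ∧ L.vertexSet T ≠ Set.univ ∧
    ∀ T', L.IsSubLOT T' → T ⊆ T' → L.vertexSet T' ≠ Set.univ → T' = T

/-- Collapse the vertices of `S` to the single new vertex `Sum.inr ()`. -/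
noncomputable def collapseV (S : Set V) (v : V) : {v : V // v ∉ S} ⊕ Unit :=
  if h : v ∈ S then Sum.inr () else Sum.inl ⟨v, h⟩

/-- The LOT obtained by collapsing the sub-LOT spanned by `T` (with vertex
set `S`) to a single vertex `y = Sum.inr ()`. -/
noncomputable def collapse (L : LOT V) (T : Set (Fin L.edges.length)) (S : Set V) :
    LOT ({v : V // v ∉ S} ⊕ Unit) :=
  ⟨((List.finRange L.edges.length).filter (fun i => decide (i ∉ T))).map
    (fun i => (collapseV S (L.edges.get i).1,
               collapseV S (L.edges.get i).2.1,
               collapseV S (L.edges.get i).2.2))⟩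

end LOT

end DDR

theorem exists_perm_fiber_fixed {O β : Type} [Finite O] (lab : O → β) :
    ∃ σ : Equiv.Perm O, (∀ o, lab (σ o) = lab o) ∧
      ∀ o, σ o = o → Nat.card {p : O // lab p = lab o} = 1 := by
  have key : ∀ b : β, ∃ τ : Equiv.Perm {p : O // lab p = b},
      ∀ q, τ q = q → Nat.card {p : O // lab p = b} = 1 := by
    intro b
    have e := Finite.equivFin {p : O // lab p = b}
    generalize Nat.card {p : O // lab p = b} = n at e
    refine ⟨e.trans ((finRotate n).trans e.symm), fun q hq => ?_⟩
    have h : finRotate n (e q) = e q := by simpa [Equiv.symm_apply_eq] using hq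
    have := Fin.pos (e q)
    obtain ⟨m, rfl⟩ : ∃ m, n = m + 1 := ⟨n - 1, by omega⟩
    cases m with
    | zero => rfl
    | succ m => simp at h
  choose τ hτ using key
  refine ⟨(Equiv.sigmaFiberEquiv lab).symm.trans
    ((Equiv.sigmaCongrRight τ).trans (Equiv.sigmaFiberEquiv lab)), fun o => ?_, fun o ho => ?_⟩
  · exact (τ (lab o) ⟨o, rfl⟩).2
  · exact hτ (lab o) ⟨o, rfl⟩ (Subtype.ext ho)

namespace DDR

open scoped Classical

theorem Word.length_inv {α : Type} (w : Word α) : (Word.inv w).length = w.length := by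
  simp [Word.inv]

theorem Word.map_inv {α β : Type} (f : α → β) (w : Word α) :
    (Word.inv w).map (fun p => (f p.1, p.2)) = Word.inv (w.map (fun p => (f p.1, p.2))) := by
  simp [Word.inv, Function.comp_def]

theorem Word.getElem?_inv {α : Type} (w : Word α) {i : ℕ} (h : i < w.length) :
    (Word.inv w)[i]? = w[w.length - 1 - i]?.map (fun p => (p.1, !p.2)) := by
  simp [Word.inv, h]

theorem countP_eq_card_fin {β : Type} (p : β → Prop) (l : List β) :
    l.countP (fun b => decide (p b)) = Nat.card {i : Fin l.length // p (l.get i)} := by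
  rw [Nat.card_eq_fintype_card, Fintype.card_subtype, Finset.card_filter]
  simp only [List.get_eq_getElem]
  rw [Fin.sum_univ_fun_getElem l (fun b => if p b then 1 else 0)]
  induction l with
  | nil => rfl
  | cons a l ih => simp [List.countP_cons, ih, add_comm]

namespace Presentation

variable {α : Type} (P : Presentation α)

/-- The occurrence of a letter in a relator is the corner following it; this is its generator. -/
def cornerLabel (o : Corner P) : α := (cornerFst P o).1

instance : Finite (Corner P) :=
  inferInstanceAs (Finite (Σ j : Fin P.relators.length, Fin (P.relators.get j).length))

theorem occCount_eq_card (x : α) :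
    P.occCount x = Nat.card {o : Corner P // P.cornerLabel o = x} := by
  have e : {o : Corner P // P.cornerLabel o = x} ≃
      Σ j : Fin P.relators.length,
        {i : Fin (P.relators.get j).length // ((P.relators.get j).get i).1 = x} :=
    { toFun := fun o => ⟨o.1.1, o.1.2, o.2⟩
      invFun := fun o => ⟨⟨o.1, o.2.1⟩, o.2.2⟩
      left_inv := fun _ => rfl
      right_inv := fun _ => rfl }
  rw [Nat.card_congr e, Nat.card_sigma, occCount]
  simp only [← countP_eq_card_fin (fun p : α × Bool => p.1 = x)]
  exact (Fin.sum_univ_fun_getElem P.relators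
    (fun w => w.countP (fun p => decide (p.1 = x)))).symm

variable (σ : Equiv.Perm (Corner P))

/-- The edge of the double of `P` glued along `σ` to which the side of `o` traversed in direction
`d` is attached. -/
def doubleEdge (d : Bool) (o : Corner P) : Corner P := if d then o else σ.symm o

/-- The boundary word of the copy of the `j`-th relator with orientation `s`, read along the
relator. -/
def doubleWord (j : Fin P.relators.length) (s : Bool) : Word (Corner P) :=
  List.ofFn fun i : Fin (P.relators.get j).length =>
    (P.doubleEdge σ (((P.relators.get j).get i).2 == s) ⟨j, i⟩, ((P.relators.get j).get i).2)

/-- The double of `P` glued along `σ`: one vertex, two copies of every relator disc, with opposite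
orientations, and one edge for each letter occurrence `o`, along which the positively traversed
side of `o` is glued to the negatively traversed side of `σ o`. -/
def double : TwoComplex where
  V := Unit
  E := Corner P
  F := Fin P.relators.length × Bool
  src := fun _ => ()
  tgt := fun _ => ()
  bdry := fun f => if f.2 then P.doubleWord σ f.1 f.2 else Word.inv (P.doubleWord σ f.1 f.2)

/-- The side of the double in which the occurrence `o` is traversed in direction `d`. -/
def doubleSide (o : Corner P) (d : Bool) : (P.double σ).F × ℕ :=
  ((o.1, (cornerFst P o).2 == d),
    if (cornerFst P o).2 == d then (o.2 : ℕ) else (P.relators.get o.1).length - 1 - o.2)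

theorem doubleEdge_eq_iff (d : Bool) (o e : Corner P) :
    P.doubleEdge σ d o = e ↔ o = if d then e else σ e := by
  cases d
  · exact σ.symm_apply_eq
  · exact Iff.rfl

theorem doubleWord_getElem? (j : Fin P.relators.length) (s : Bool)
    (i : Fin (P.relators.get j).length) :
    (P.doubleWord σ j s)[(i : ℕ)]? = some
      (P.doubleEdge σ (((P.relators.get j).get i).2 == s) ⟨j, i⟩,
        ((P.relators.get j).get i).2) := by
  rw [doubleWord, List.getElem?_ofFn, dif_pos i.2]

theorem length_double_bdry (f : (P.double σ).F) :
    ((P.double σ).bdry f).length = (P.relators.get f.1).length := by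
  obtain ⟨j, _ | _⟩ := f <;> simp [double, Word.length_inv, doubleWord]

theorem doubleSide_of_beq {o : Corner P} {d s : Bool} (h : ((cornerFst P o).2 == d) = s) :
    P.doubleSide σ o d =
      ((o.1, s), if s then (o.2 : ℕ) else (P.relators.get o.1).length - 1 - o.2) := by
  subst h
  rfl

theorem double_bdry_getElem? (o : Corner P) (d : Bool) :
    ((P.double σ).bdry (P.doubleSide σ o d).1)[(P.doubleSide σ o d).2]? =
      some (P.doubleEdge σ d o, d) := by
  rcases h : (cornerFst P o).2 == d with _ | _
  · rw [P.doubleSide_of_beq σ h]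
    have hl : (P.doubleWord σ o.1 false).length = (P.relators.get o.1).length := by
      simp [doubleWord]
    have hi : (P.relators.get o.1).length - 1 - o.2 < (P.doubleWord σ o.1 false).length := by
      omega
    have hn : (P.doubleWord σ o.1 false).length - 1 -
        ((P.relators.get o.1).length - 1 - o.2) = o.2 := by
      omega
    refine (Word.getElem?_inv _ hi).trans ?_
    rw [hn, doubleWord_getElem?]
    change some (P.doubleEdge σ ((cornerFst P o).2 == false) o, !(cornerFst P o).2) = _
    generalize (cornerFst P o).2 = ε at h ⊢
    cases ε <;> cases d <;> first | rfl | cases h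
  · rw [P.doubleSide_of_beq σ h]
    refine (P.doubleWord_getElem? σ o.1 true o.2).trans ?_
    change some (P.doubleEdge σ ((cornerFst P o).2 == true) o, (cornerFst P o).2) = _
    generalize (cornerFst P o).2 = ε at h ⊢
    cases ε <;> cases d <;> first | rfl | cases h

theorem exists_doubleSide (f : (P.double σ).F) {k : ℕ} (hk : k < (P.relators.get f.1).length) :
    ∃ o d, (f, k) = P.doubleSide σ o d := by
  obtain ⟨j, s⟩ := f
  have hb : ∀ ε : Bool, (ε == (ε == s)) = s := by
    intro ε
    cases ε <;> cases s <;> rfl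
  have hk' : (P.relators.get j).length - 1 - k < (P.relators.get j).length := by
    simp only at hk
    omega
  cases s
  · let o : Corner P := ⟨j, ⟨_, hk'⟩⟩
    refine ⟨o, (cornerFst P o).2 == false, ?_⟩
    rw [P.doubleSide_of_beq σ (hb (cornerFst P o).2)]
    refine Prod.ext rfl ?_
    change k = (P.relators.get j).length - 1 - ((P.relators.get j).length - 1 - k)
    simp only at hk
    omega
  · let o : Corner P := ⟨j, ⟨k, hk⟩⟩
    exact ⟨o, (cornerFst P o).2 == true, (P.doubleSide_of_beq σ (o := o) (hb _)).symm⟩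

theorem double_bdry_getElem?_iff (e : Corner P) (f : (P.double σ).F) (k : ℕ) (d : Bool) :
    ((P.double σ).bdry f)[k]? = some (e, d) ↔
      (f, k) = P.doubleSide σ (if d then e else σ e) d := by
  constructor
  · intro h
    obtain ⟨hk, -⟩ := List.getElem?_eq_some_iff.1 h
    rw [length_double_bdry] at hk
    obtain ⟨o, d', hs⟩ := P.exists_doubleSide σ f hk
    obtain ⟨rfl, rfl⟩ := Prod.ext_iff.1 hs
    rw [double_bdry_getElem?] at h
    obtain ⟨ho, rfl⟩ := Prod.ext_iff.1 (Option.some.inj h)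
    rw [← (P.doubleEdge_eq_iff σ _ _ _).1 ho]
  · intro h
    obtain ⟨rfl, rfl⟩ := Prod.ext_iff.1 h
    rw [double_bdry_getElem?, (P.doubleEdge_eq_iff σ _ _ _).2 rfl]

theorem double_isClosedSurface : (P.double σ).IsClosedSurface := by
  refine ⟨⟨inferInstanceAs (Finite Unit), inferInstanceAs (Finite (Corner P)),
    inferInstanceAs (Finite (Fin P.relators.length × Bool))⟩, ⟨⟨()⟩, fun _ _ => .refl⟩, fun e => ?_⟩
  let E : (P.double σ).Occ e ≃ Bool :=
    { toFun := fun o => o.1.2.2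
      invFun := fun d => ⟨((P.doubleSide σ (if d then e else σ e) d).1,
        (P.doubleSide σ (if d then e else σ e) d).2, d),
        (P.double_bdry_getElem?_iff σ e _ _ _).2 rfl⟩
      left_inv := by
        rintro ⟨⟨f, k, d⟩, h⟩
        have h' := (P.double_bdry_getElem?_iff σ e _ _ _).1 h
        refine Subtype.ext ?_
        simp only [← h']
      right_inv := fun _ => rfl }
  rw [Nat.card_congr E]
  simp

theorem double_side_eq {e : Corner P} (o : (P.double σ).Occ e) :
    (o.1.1, o.1.2.1) = P.doubleSide σ (if o.1.2.2 then e else σ e) o.1.2.2 :=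
  (P.double_bdry_getElem?_iff σ e _ _ _).1 o.2

theorem double_dir_ne {e : Corner P} {o₁ o₂ : (P.double σ).Occ e}
    (h : (o₁.1.1, o₁.1.2.1) ≠ (o₂.1.1, o₂.1.2.1)) : o₁.1.2.2 ≠ o₂.1.2.2 := by
  intro hd
  rw [double_side_eq, double_side_eq, hd] at h
  exact h rfl

theorem double_orientable : (P.double σ).Orientable :=
  ⟨fun _ => true, fun _ _ _ h => by simpa using P.double_dir_ne σ h⟩

variable {σ}

/-- The labelling of the double by `K(P)`, when `σ` preserves labels. -/
def doubleMap (hσ : ∀ o, P.cornerLabel (σ o) = P.cornerLabel o) :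
    CombMap (P.double σ) P.complex where
  onV := fun _ => ()
  onE := P.cornerLabel
  onF := Prod.fst
  src_eq := fun _ => rfl
  tgt_eq := fun _ => rfl
  sgn := Prod.snd
  rot := fun _ => 0
  bdry_eq := by
    have hσ' : ∀ o, P.cornerLabel (σ.symm o) = P.cornerLabel o := fun o => by
      simpa using (hσ (σ.symm o)).symm
    have hw : ∀ j s, (P.doubleWord σ j s).map (fun p => (P.cornerLabel p.1, p.2)) =
        P.relators.get j := by
      intro j s
      have hd : ∀ d o, P.cornerLabel (P.doubleEdge σ d o) = P.cornerLabel o := by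
        intro d o
        cases d
        · exact hσ' o
        · rfl
      rw [doubleWord, List.map_ofFn]
      exact (congrArg List.ofFn (funext fun i =>
        congrArg (fun a => (a, ((P.relators.get j).get i).2))
          (hd (((P.relators.get j).get i).2 == s) ⟨j, i⟩))).trans
        (List.ofFn_get _)
    rintro ⟨j, _ | _⟩
    · simpa [double, complex, Word.map_inv] using congrArg Word.inv (hw j false)
    · simpa [double, complex] using hw j true

theorem doubleMap_kIndex (hσ : ∀ o, P.cornerLabel (σ o) = P.cornerLabel o) (o : Corner P)
    (d : Bool) :
    (P.doubleMap hσ).kIndex (P.doubleSide σ o d).1 (P.doubleSide σ o d).2 = o.2 := by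
  have hi := o.2.2
  have hi' : (P.relators.get o.1).length - 1 - o.2 < (P.relators.get o.1).length := by omega
  rcases h : (cornerFst P o).2 == d with _ | _
  · rw [P.doubleSide_of_beq σ h]
    change (P.relators.get o.1).length - 1 -
      ((P.relators.get o.1).length - 1 - o.2 + 0) % (P.relators.get o.1).length = o.2
    rw [add_zero, Nat.mod_eq_of_lt hi']
    omega
  · rw [P.doubleSide_of_beq σ h]
    exact Nat.mod_eq_of_lt hi

theorem fixed_of_foldingEdge (hσ : ∀ o, P.cornerLabel (σ o) = P.cornerLabel o) {e : Corner P}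
    (h : (P.doubleMap hσ).FoldingEdge e) : σ e = e := by
  have ext_corner : ∀ {o o' : Corner P} {d d' : Bool},
      (P.doubleSide σ o d).1.1 = (P.doubleSide σ o' d').1.1 →
      (P.doubleMap hσ).kIndex (P.doubleSide σ o d).1 (P.doubleSide σ o d).2 =
        (P.doubleMap hσ).kIndex (P.doubleSide σ o' d').1 (P.doubleSide σ o' d').2 → o = o' := by
    rintro ⟨j, i⟩ ⟨j', i'⟩ d d' hj hi
    obtain rfl : j = j' := hj
    exact congrArg (Sigma.mk j) (Fin.ext
      ((P.doubleMap_kIndex hσ _ _).symm.trans (hi.trans (P.doubleMap_kIndex hσ _ _))))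
  obtain ⟨o₁, o₂, hne, hF, -, hk⟩ := h
  have hd := P.double_dir_ne σ hne
  have h₁ := Prod.ext_iff.1 (P.double_side_eq σ o₁)
  have h₂ := Prod.ext_iff.1 (P.double_side_eq σ o₂)
  simp only at h₁ h₂
  rw [h₁.1, h₁.2, h₂.1, h₂.2] at hk
  rw [h₁.1, h₂.1] at hF
  have ho := ext_corner hF hk
  generalize o₁.1.2.2 = d₁ at hd ho
  generalize o₂.1.2.2 = d₂ at hd ho
  cases d₁ <;> cases d₂
  · exact absurd rfl hd
  · exact ho
  · exact ho.symm
  · exact absurd rfl hd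

end Presentation

end DDR

/-- Let `P` be a finite presentation and let `S₀` be the set
of generators corresponding to the free edges of `K(P)` (those occurring
exactly once in total among the relators).  Let `x` be a generator contained
in some relator but not in `S₀`.  Then there exists a closed oriented surface
diagram `f : F → K(P)` containing an edge labeled `x` which is reducible only
at edges labeled by elements of `S₀`: every folding edge of `F` carries a
label from `S₀`. -/
theorem stmt_6 {α : Type} (P : DDR.Presentation α) (x : α)
    (hx : 0 < P.occCount x) (hxnotfree : P.occCount x ≠ 1) :
    ∃ (F : DDR.TwoComplex) (φ : DDR.CombMap F P.complex),
      F.IsClosedSurface ∧ F.Orientable ∧ (∃ e, φ.onE e = x) ∧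
      ∀ e, φ.FoldingEdge e → P.occCount (φ.onE e) = 1 := by
  obtain ⟨σ, hσ, hfix⟩ := exists_perm_fiber_fixed P.cornerLabel
  refine ⟨P.double σ, P.doubleMap hσ, P.double_isClosedSurface σ, P.double_orientable σ, ?_,
    fun e he => ?_⟩
  · rw [P.occCount_eq_card, Nat.card_pos_iff] at hx
    obtain ⟨o, ho⟩ := hx.1
    exact ⟨o, ho⟩
  · exact (P.occCount_eq_card _).trans (hfix e (P.fixed_of_foldingEdge hσ he))
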